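/- Let φ, ρ ∈ ℚ(X) be non-zero multiplicatively independent rational functions. There exist effectively computable constants c_1, c_2, c_3 depending only on φ and ρ such that for every prime p > c_1, for all but at most c_2 elements α in the algebraic closure of 𝔽_p (excluding zeros and poles of the reductions of φ, ρ), max(ord_p(φ(α)), ord_p(ρ(α))) ≥ c_3·(log p)^{1/2}, where ord_p(β) denotes the multiplicative order of β ∈ \overline{𝔽}_p*. -/

import Mathlib

open Polynomial

lemma tot_bound (n : ℕ) (hn : 0 < n) : n ^ 2 ≤ 8 * n.totient ^ 3 := by
  have h := Nat.totient_mul_prod_primeFactors n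
  set P := ∏ p ∈ n.primeFactors, p with hP
  set Q := ∏ p ∈ n.primeFactors, (p - 1) with hQ
  have hPpos : 0 < P := Finset.prod_pos fun p hp => (Nat.prime_of_mem_primeFactors hp).pos
  have hPn : P ≤ n := Nat.le_of_dvd hn (Nat.prod_primeFactors_dvd n)
  have hPQ : P ^ 2 ≤ 8 * Q ^ 3 := by
    let w : ℕ → ℕ := fun p => if p = 2 then 4 else if p = 3 then 2 else 1
    have h1 : P ^ 2 ≤ ∏ p ∈ n.primeFactors, w p * (p - 1) ^ 3 := by
      rw [hP, ← Finset.prod_pow]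
      apply Finset.prod_le_prod' 
      intro p hp
      have hp2 := (Nat.prime_of_mem_primeFactors hp).two_le
      simp only [w]
      split_ifs with h2 h3
      · subst h2; norm_num
      · subst h3; norm_num
      · have : 4 ≤ p := by omega
        obtain ⟨k, rfl⟩ := Nat.exists_eq_add_of_le this
        rw [show 4 + k - 1 = k + 3 by omega]
        ring_nf
        nlinarith [sq_nonneg k, Nat.zero_le (k^3)]
    have h2 : ∏ p ∈ n.primeFactors, w p ≤ 8 := by
      calc ∏ p ∈ n.primeFactors, w p ≤ ∏ p ∈ n.primeFactors ∪ {2,3}, w p := by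
            apply Finset.prod_le_prod_of_subset_of_one_le' Finset.subset_union_left
            intro i _ _
            simp only [w]; split_ifs <;> norm_num
        _ = ∏ p ∈ ({2,3} : Finset ℕ), w p := by
            symm
            apply Finset.prod_subset Finset.subset_union_right
            intro x _ hx
            simp at hx
            simp [w, hx]
        _ = 8 := by simp [w]
    rw [Finset.prod_mul_distrib, Finset.prod_pow] at h1
    exact h1.trans (Nat.mul_le_mul_right _ h2)
  have h3 : n.totient ^ 3 * P ^ 3 = n ^ 3 * Q ^ 3 := by
    rw [← mul_pow, ← mul_pow, h]
  have : n ^ 2 * P ^ 3 ≤ 8 * n.totient ^ 3 * P ^ 3 := by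
    calc n ^ 2 * P ^ 3 = n ^ 2 * P * P ^ 2 := by ring
      _ ≤ n ^ 2 * n * (8 * Q ^ 3) := by gcongr
      _ = 8 * (n ^ 3 * Q ^ 3) := by ring
      _ = _ := by rw [← h3]; ring
  exact Nat.le_of_mul_le_mul_right this (by positivity)

lemma torsion_bound (f₁ g₁ f₂ g₂ : ℤ[X])
    (hind : ∀ i j i' j' : ℕ, f₁ ^ i * f₂ ^ j * (g₁ ^ i' * g₂ ^ j') =
      f₁ ^ i' * f₂ ^ j' * (g₁ ^ i * g₂ ^ j) → i = i' ∧ j = j') :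
    ∃ N₀ : ℕ, ∀ (z : ℂ) (m n : ℕ), 0 < m → 0 < n → aeval z g₁ ≠ 0 → aeval z g₂ ≠ 0 →
      IsPrimitiveRoot (aeval z f₁ / aeval z g₁) m → IsPrimitiveRoot (aeval z f₂ / aeval z g₂) n →
      Nat.lcm m n < N₀ := by
  set D := f₁.natDegree + f₂.natDegree + g₁.natDegree + g₂.natDegree with hD
  refine ⟨(8 * D ^ 3 + 1) ^ 2, ?_⟩
  intro z m n hm hn hz1 hz2 h1 h2
  set a := aeval z f₁ / aeval z g₁ with ha
  set b := aeval z f₂ / aeval z g₂ with hb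
  set N := Nat.lcm m n with hN
  have hNpos : 0 < N := Nat.lcm_pos hm hn
  set s := Nat.sqrt N with hs
  have haN : a ^ N = 1 := by
    obtain ⟨k, hk⟩ := Nat.dvd_lcm_left m n
    rw [hN, hk, pow_mul, h1.pow_eq_one, one_pow]
  have hbN : b ^ N = 1 := by
    obtain ⟨k, hk⟩ := Nat.dvd_lcm_right m n
    rw [hN, hk, pow_mul, h2.pow_eq_one, one_pow]
  have ha0 : a ≠ 0 := h1.ne_zero hm.ne'
  have hb0 : b ≠ 0 := h2.ne_zero hn.ne'
  obtain ⟨x, hx, y, hy, hxy, hval⟩ : ∃ x ∈ Finset.range (s+1) ×ˢ Finset.range (s+1),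
      ∃ y ∈ Finset.range (s+1) ×ˢ Finset.range (s+1), x ≠ y ∧
        a ^ x.1 * b ^ x.2 = a ^ y.1 * b ^ y.2 := by
    apply Finset.exists_ne_map_eq_of_card_lt_of_maps_to (t := (nthRoots N (1:ℂ)).toFinset)
    · calc (nthRoots N (1:ℂ)).toFinset.card ≤ (nthRoots N (1:ℂ)).card := Multiset.toFinset_card_le _
        _ ≤ N := card_nthRoots N 1
        _ < (s+1)*(s+1) := Nat.lt_succ_sqrt N
        _ = _ := by simp
    · intro x hx
      simp only [Finset.mem_coe, Multiset.mem_toFinset]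
      rw [mem_nthRoots hNpos, mul_pow, ← pow_mul, ← pow_mul, mul_comm, mul_comm x.1, pow_mul a, haN, mul_comm x.2, pow_mul b, hbN]
      simp
  simp only [Finset.mem_product, Finset.mem_range, Nat.lt_succ_iff] at hx hy
  set P : ℤ[X] := f₁ ^ x.1 * f₂ ^ x.2 * (g₁ ^ y.1 * g₂ ^ y.2) -
    f₁ ^ y.1 * f₂ ^ y.2 * (g₁ ^ x.1 * g₂ ^ x.2) with hP
  have hP0 : P ≠ 0 := by
    intro h
    have := hind _ _ _ _ (sub_eq_zero.mp h)
    exact hxy (Prod.ext this.1 this.2)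
  have hPz : aeval z P = 0 := by
    have e1 : aeval z f₁ = a * aeval z g₁ := by rw [ha]; field_simp
    have e2 : aeval z f₂ = b * aeval z g₂ := by rw [hb]; field_simp
    simp only [hP, map_sub, map_mul, map_pow, e1, e2]
    linear_combination (aeval z g₁ ^ (x.1 + y.1) * aeval z g₂ ^ (x.2 + y.2)) * hval
  have hdeg : P.natDegree ≤ s * D := by
    have key : ∀ i j i' j' : ℕ, i ≤ s → j ≤ s → i' ≤ s → j' ≤ s →
        (f₁ ^ i * f₂ ^ j * (g₁ ^ i' * g₂ ^ j')).natDegree ≤ s * D := by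
      intro i j i' j' hi hj hi' hj'
      have := natDegree_mul_le (p := f₁ ^ i * f₂ ^ j) (q := g₁ ^ i' * g₂ ^ j')
      have := natDegree_mul_le (p := f₁ ^ i) (q := f₂ ^ j)
      have := natDegree_mul_le (p := g₁ ^ i') (q := g₂ ^ j')
      have := natDegree_pow_le (p := f₁) (n := i)
      have := natDegree_pow_le (p := f₂) (n := j)
      have := natDegree_pow_le (p := g₁) (n := i')
      have := natDegree_pow_le (p := g₂) (n := j')
      have := Nat.mul_le_mul_right f₁.natDegree hi
      have := Nat.mul_le_mul_right f₂.natDegree hj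
      have := Nat.mul_le_mul_right g₁.natDegree hi'
      have := Nat.mul_le_mul_right g₂.natDegree hj'
      rw [hD, mul_add, mul_add, mul_add]
      omega
    refine (natDegree_sub_le _ _).trans (max_le ?_ ?_)
    · exact key _ _ _ _ hx.1 hx.2 hy.1 hy.2
    · exact key _ _ _ _ hy.1 hy.2 hx.1 hx.2
  set PQ : ℚ[X] := P.map (Int.castRingHom ℚ)
  have hPQ0 : PQ ≠ 0 := (Polynomial.map_ne_zero_iff (RingHom.injective_int _)).mpr hP0
  have hPQz : aeval z PQ = 0 := by
    rw [← hPz]; exact aeval_map_algebraMap ℚ z P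
  have hIntz : IsIntegral ℚ z := IsAlgebraic.isIntegral ⟨PQ, hPQ0, hPQz⟩
  have : FiniteDimensional ℚ (IntermediateField.adjoin ℚ {z}) :=
    IntermediateField.adjoin.finiteDimensional hIntz
  have hmem : ∀ f : ℤ[X], aeval z f ∈ IntermediateField.adjoin ℚ {z} := by
    intro f
    rw [← aeval_map_algebraMap ℚ z f]
    have := aeval_mem_adjoin_singleton ℚ z (p := f.map (algebraMap ℤ ℚ))
    exact IntermediateField.algebra_adjoin_le_adjoin ℚ _ this
  have hfin : N.totient ≤ Module.finrank ℚ (IntermediateField.adjoin ℚ {z}) := by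
    have ham : a ∈ IntermediateField.adjoin ℚ {z} := div_mem (hmem _) (hmem _)
    have hbm : b ∈ IntermediateField.adjoin ℚ {z} := div_mem (hmem _) (hmem _)
    refine IsPrimitiveRoot.lcm_totient_le_finrank (x := ⟨a, ham⟩) (y := ⟨b, hbm⟩) ?_ ?_
      (cyclotomic.irreducible_rat hNpos)
    · exact IsPrimitiveRoot.of_map_of_injective (f := (IntermediateField.adjoin ℚ {z}).val) h1
        (RingHom.injective _)
    · exact IsPrimitiveRoot.of_map_of_injective (f := (IntermediateField.adjoin ℚ {z}).val) h2
        (RingHom.injective _)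
  rw [IntermediateField.adjoin.finrank hIntz] at hfin
  have h3 : (minpoly ℚ z).natDegree ≤ PQ.natDegree :=
    natDegree_le_of_dvd (minpoly.dvd ℚ z hPQz) hPQ0
  have h4 : PQ.natDegree ≤ P.natDegree := natDegree_map_le
  have h5 : N.totient ≤ s * D := by omega
  have h6 := tot_bound N hNpos
  have h7 : s * s ≤ N := Nat.sqrt_le N
  have h8 : N < (s + 1) * (s + 1) := Nat.lt_succ_sqrt N
  have hspos : 0 < s := Nat.sqrt_pos.mpr hNpos
  have h9 : s ^ 3 * s ≤ s ^ 3 * (8 * D ^ 3) := by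
    calc s ^ 3 * s = (s * s) ^ 2 := by ring
      _ ≤ N ^ 2 := by gcongr
      _ ≤ 8 * N.totient ^ 3 := h6
      _ ≤ 8 * (s * D) ^ 3 := by gcongr
      _ = _ := by ring
  have h10 : s ≤ 8 * D ^ 3 := Nat.le_of_mul_le_mul_left h9 (by positivity)
  calc N < (s + 1) * (s + 1) := h8
    _ = (s + 1) ^ 2 := by ring
    _ ≤ _ := by gcongr

lemma no_common_root (f g : ℤ[X]) (hf : f ≠ 0) (h : IsRelPrime f g) (z : ℂ)
    (h1 : aeval z f = 0) (h2 : aeval z g = 0) : False := by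
  have hfQ : f.map (algebraMap ℤ ℚ) ≠ 0 :=
    (Polynomial.map_ne_zero_iff (RingHom.injective_int _)).mpr hf
  have hIntz : IsIntegral ℚ z := IsAlgebraic.isIntegral
    ⟨f.map (algebraMap ℤ ℚ), hfQ, by rw [aeval_map_algebraMap]; exact h1⟩
  obtain ⟨b, hb, hb'⟩ := IsLocalization.integerNormalization_spec (nonZeroDivisors ℤ) (minpoly ℚ z)
  set P := IsLocalization.integerNormalization (nonZeroDivisors ℤ) (minpoly ℚ z) with hP
  have hP0 : P ≠ 0 := by
    rw [hP, Ne, IsFractionRing.integerNormalization_eq_zero_iff]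
    exact minpoly.ne_zero hIntz
  have hPz : aeval z P = 0 :=
    IsLocalization.integerNormalization_aeval_eq_zero (nonZeroDivisors ℤ) _ (minpoly.aeval ℚ z)
  have hb0 : (b : ℚ) ≠ 0 := by exact_mod_cast nonZeroDivisors.ne_zero hb
  have hdvd : ∀ q : ℤ[X], aeval z q = 0 → P.primPart ∣ q := by
    intro q hq
    apply (P.isPrimitive_primPart).dvd_of_fraction_map_dvd_fraction_map (K := ℚ)
    have a1 : P.primPart.map (algebraMap ℤ ℚ) ∣ P.map (algebraMap ℤ ℚ) :=
      Polynomial.map_dvd _ P.primPart_dvd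
    refine a1.trans ?_
    rw [hb']
    have a2 : minpoly ℚ z ∣ q.map (algebraMap ℤ ℚ) :=
      minpoly.dvd ℚ z (by rw [aeval_map_algebraMap]; exact hq)
    obtain ⟨r, hr⟩ := a2
    refine ⟨C ((b : ℚ)⁻¹) * r, ?_⟩
    rw [hr, zsmul_eq_mul, ← map_intCast (C : ℚ →+* ℚ[X])]
    have : (C (b:ℚ)) * C ((b:ℚ)⁻¹) = 1 := by rw [← C_mul, mul_inv_cancel₀ hb0, C_1]
    linear_combination (-(minpoly ℚ z) * r) * this
  have hu : IsUnit P.primPart := h (hdvd f h1) (hdvd g h2)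
  obtain ⟨r, hr, hr'⟩ := Polynomial.isUnit_iff.mp hu
  have e : aeval z P = (P.content : ℂ) * r := by
    conv_lhs => rw [P.eq_C_content_mul_primPart, ← hr']
    simp
  rw [hPz] at e
  have c0 : P.content ≠ 0 := by rwa [Ne, content_eq_zero_iff]
  have r0 : r ≠ 0 := hr.ne_zero
  have : (P.content : ℂ) * r ≠ 0 := mul_ne_zero (by exact_mod_cast c0) (by exact_mod_cast r0)
  exact this e.symm

/-- homogenised cyclotomic polynomial evaluated at `(f, g)` -/
noncomputable def psi (m : ℕ) (f g : ℤ[X]) : ℤ[X] :=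
  MvPolynomial.aeval ![f, g] ((cyclotomic m ℤ).homogenize m.totient)

lemma psi_map {A : Type*} [CommRing A] (φ : ℤ[X] →+* A) (m : ℕ) (f g : ℤ[X]) :
    φ (psi m f g) =
      MvPolynomial.eval₂ (Int.castRingHom A) ![φ f, φ g] ((cyclotomic m ℤ).homogenize m.totient) := by
  rw [psi, MvPolynomial.aeval_def, MvPolynomial.hom_eval₂]
  congr 1
  · exact RingHom.ext_int _ _
  · ext i; fin_cases i <;> rfl

lemma psi_prod (m : ℕ) (hm : 0 < m) (f g : ℤ[X]) :
    (psi m f g).map (Int.castRingHom ℂ) = ∏ μ ∈ primitiveRoots m ℂ,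
      (f.map (Int.castRingHom ℂ) - C μ * g.map (Int.castRingHom ℂ)) := by
  have h := psi_map (mapRingHom (Int.castRingHom ℂ)) m f g
  simp only [coe_mapRingHom] at h
  rw [h]
  have e : (Int.castRingHom ℂ[X]) = (C : ℂ →+* ℂ[X]).comp (Int.castRingHom ℂ) := RingHom.ext_int _ _
  rw [e, ← MvPolynomial.eval₂_map, ← homogenize_map, map_cyclotomic,
    cyclotomic_eq_prod_X_sub_primitiveRoots (Complex.isPrimitiveRoot_exp m hm.ne')]
  have hc : m.totient = ∑ μ ∈ primitiveRoots m ℂ, 1 := by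
    rw [Finset.sum_const, (Complex.isPrimitiveRoot_exp m hm.ne').card_primitiveRoots]; simp
  rw [hc, homogenize_finsetProd (by intro i _; simp), MvPolynomial.eval₂_prod]
  apply Finset.prod_congr rfl
  intro μ _
  simp

lemma psi_root {K : Type*} [Field K] (m : ℕ) (hm : 0 < m) (f g : ℤ[X]) (α : K)
    (hg : eval₂ (Int.castRingHom K) α g ≠ 0)
    (h : IsPrimitiveRoot (eval₂ (Int.castRingHom K) α f / eval₂ (Int.castRingHom K) α g) m) :
    eval₂ (Int.castRingHom K) α (psi m f g) = 0 := by
  have h' := psi_map (eval₂RingHom (Int.castRingHom K) α) m f g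
  simp only [coe_eval₂RingHom] at h'
  rw [h', ← MvPolynomial.eval_map, ← homogenize_map, map_cyclotomic,
    eval_homogenize (natDegree_cyclotomic_le) _ (by simpa using hg)]
  have := h.isRoot_cyclotomic hm
  rw [IsRoot.def] at this
  simp [this]

/-- length of a polynomial -/
noncomputable def len (f : ℤ[X]) : ℝ :=
  ∑ i ∈ Finset.range (f.natDegree + 1), ‖(f.coeff i : ℂ)‖

lemma len_nonneg (f : ℤ[X]) : 0 ≤ len f := Finset.sum_nonneg fun _ _ => norm_nonneg _

lemma one_le_len (f : ℤ[X]) (hf : f ≠ 0) : 1 ≤ len f := by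
  have h1 : ‖(f.coeff f.natDegree : ℂ)‖ ≤ len f :=
    Finset.single_le_sum (f := fun i => ‖(f.coeff i : ℂ)‖) (fun _ _ => norm_nonneg _) (by simp)
  refine le_trans ?_ h1
  rw [Complex.norm_intCast]
  have : f.coeff f.natDegree ≠ 0 := by simpa using hf
  exact_mod_cast Int.one_le_abs this

lemma eval_le_len (f : ℤ[X]) (D : ℕ) (hD : f.natDegree ≤ D) (z : ℂ) :
    ‖(f.map (Int.castRingHom ℂ)).eval z‖ ≤ len f * (max 1 ‖z‖) ^ D := by
  rw [eval_map, eval₂_eq_sum_range, len, Finset.sum_mul]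
  refine (norm_sum_le _ _).trans (Finset.sum_le_sum fun i hi => ?_)
  rw [norm_mul, norm_pow]
  simp only [eq_intCast]
  gcongr
  calc ‖z‖ ^ i ≤ (max 1 ‖z‖) ^ i := by gcongr; exact le_max_right _ _
    _ ≤ _ := pow_le_pow_right₀ (le_max_left _ _) (by simp at hi; omega)

lemma lin_eval (f g : ℤ[X]) (D : ℕ) (hf : f.natDegree ≤ D) (hg : g.natDegree ≤ D) (μ z : ℂ)
    (hμ : ‖μ‖ = 1) :
    ‖(f.map (Int.castRingHom ℂ) - C μ * g.map (Int.castRingHom ℂ)).eval z‖ ≤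
      (len f + len g) * (max 1 ‖z‖) ^ D := by
  rw [eval_sub, eval_mul, eval_C, add_mul]
  refine (norm_sub_le _ _).trans (add_le_add (eval_le_len f D hf z) ?_)
  rw [norm_mul, hμ, one_mul]
  exact eval_le_len g D hg z

lemma lin_mahler (f g : ℤ[X]) (D : ℕ) (hf : f.natDegree ≤ D) (hg : g.natDegree ≤ D) (μ : ℂ)
    (hμ : ‖μ‖ = 1) :
    (f.map (Int.castRingHom ℂ) - C μ * g.map (Int.castRingHom ℂ)).mahlerMeasure ≤
      (len f + len g) := by
  set q := f.map (Int.castRingHom ℂ) - C μ * g.map (Int.castRingHom ℂ) with hq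
  have hlen : ∀ f : ℤ[X], f.natDegree ≤ D →
      len f = ∑ i ∈ Finset.range (D + 1), ‖(f.coeff i : ℂ)‖ := by
    intro f hf
    rw [len]
    apply Finset.sum_subset
    · intro i; simp; omega
    · intro i _ hi
      simp at hi
      rw [coeff_eq_zero_of_natDegree_lt (by omega)]; simp
  have hqd : q.natDegree < D + 1 := by
    apply Nat.lt_succ_of_le
    refine (natDegree_sub_le _ _).trans (max_le (natDegree_map_le.trans hf) ?_)
    exact (natDegree_C_mul_le _ _).trans (natDegree_map_le.trans hg)
  refine (mahlerMeasure_le_sum_norm_coeff q).trans ?_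
  rw [sum_over_range' q (fun _ => norm_zero) (D+1) hqd, hlen f hf, hlen g hg, ← Finset.sum_add_distrib]
  apply Finset.sum_le_sum
  intro i _
  rw [hq, coeff_sub, coeff_C_mul, coeff_map, coeff_map]
  refine (norm_sub_le _ _).trans ?_
  rw [norm_mul, hμ, one_mul]
  simp

lemma psi_eval_bound (m : ℕ) (hm : 0 < m) (f g : ℤ[X]) (D : ℕ) (hf : f.natDegree ≤ D)
    (hg : g.natDegree ≤ D) (z : ℂ) :
    ‖((psi m f g).map (Int.castRingHom ℂ)).eval z‖ ≤
      (len f + len g) ^ m.totient * ((max 1 ‖z‖) ^ (m.totient * D)) := by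
  rw [psi_prod m hm, eval_prod, norm_prod, mul_comm m.totient D, pow_mul, ← mul_pow,
    ← (Complex.isPrimitiveRoot_exp m hm.ne').card_primitiveRoots, ← Finset.prod_const]
  apply Finset.prod_le_prod (fun _ _ => norm_nonneg _)
  intro μ hμ
  exact lin_eval f g D hf hg μ z (((mem_primitiveRoots hm).mp hμ).norm'_eq_one hm.ne')

lemma psi_mahler (m : ℕ) (hm : 0 < m) (f g : ℤ[X]) (D : ℕ) (hf : f.natDegree ≤ D)
    (hg : g.natDegree ≤ D) :
    ((psi m f g).map (Int.castRingHom ℂ)).mahlerMeasure ≤ (len f + len g) ^ m.totient := by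
  rw [psi_prod m hm, Finset.prod, prod_mahlerMeasure_eq_mahlerMeasure_prod, Multiset.map_map,
    ← (Complex.isPrimitiveRoot_exp m hm.ne').card_primitiveRoots, ← Finset.prod_const]
  apply Finset.prod_le_prod (fun _ _ => mahlerMeasure_nonneg _)
  intro μ hμ
  exact lin_mahler f g D hf hg μ (((mem_primitiveRoots hm).mp hμ).norm'_eq_one hm.ne')

lemma psi_natDegree (m : ℕ) (hm : 0 < m) (f g : ℤ[X]) (D : ℕ) (hf : f.natDegree ≤ D)
    (hg : g.natDegree ≤ D) : (psi m f g).natDegree ≤ m.totient * D := by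
  have : ((psi m f g).map (Int.castRingHom ℂ)).natDegree = (psi m f g).natDegree :=
    natDegree_map_eq_of_injective (RingHom.injective_int _) _
  rw [← this, psi_prod m hm]
  refine (natDegree_prod_le _ _).trans ?_
  rw [← (Complex.isPrimitiveRoot_exp m hm.ne').card_primitiveRoots]
  apply Finset.sum_le_card_nsmul
  intro μ _
  refine (natDegree_sub_le _ _).trans (max_le (natDegree_map_le.trans hf) ?_)
  exact (natDegree_C_mul_le _ _).trans (natDegree_map_le.trans hg)

lemma res_bound (m n : ℕ) (hm : 0 < m) (hn : 0 < n) (f₁ g₁ f₂ g₂ : ℤ[X]) (D : ℕ)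
    (hD₁ : f₁.natDegree ≤ D) (hD₂ : g₁.natDegree ≤ D) (hD₃ : f₂.natDegree ≤ D)
    (hD₄ : g₂.natDegree ≤ D) (B : ℝ) (hB : 1 ≤ B) (hB₁ : len f₁ + len g₁ ≤ B)
    (hB₂ : len f₂ + len g₂ ≤ B) :
    |((resultant (psi m f₁ g₁) (psi n f₂ g₂) (psi m f₁ g₁).natDegree (n.totient * D) : ℤ) : ℝ)| ≤
      B ^ (2 * D * (m * n)) := by
  set F := psi m f₁ g₁
  set G := psi n f₂ g₂
  set d := n.totient * D with hd
  have hFd : F.natDegree ≤ m.totient * D := psi_natDegree m hm _ _ D hD₁ hD₂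
  have hGd : G.natDegree ≤ d := psi_natDegree n hn _ _ D hD₃ hD₄
  have hinj : Function.Injective (Int.castRingHom ℂ) := RingHom.injective_int _
  set FC := F.map (Int.castRingHom ℂ) with hFC
  set GC := G.map (Int.castRingHom ℂ) with hGC
  have hFCd : FC.natDegree = F.natDegree := natDegree_map_eq_of_injective hinj _
  have e1 : ((resultant F G F.natDegree d : ℤ) : ℂ) = resultant FC GC FC.natDegree d := by
    rw [hFCd, resultant_map_map]; rfl
  have e2 : |((resultant F G F.natDegree d : ℤ) : ℝ)| = ‖resultant FC GC FC.natDegree d‖ := by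
    rw [← e1, Complex.norm_intCast]
  rw [e2, resultant_eq_prod_eval FC GC d (natDegree_map_le.trans hGd) (IsAlgClosed.splits _)]
  have hM : FC.mahlerMeasure ≤ B ^ m.totient :=
    (psi_mahler m hm f₁ g₁ D hD₁ hD₂).trans
      (pow_le_pow_left₀ (add_nonneg (len_nonneg _) (len_nonneg _)) hB₁ _)
  have hE : ∀ z, ‖GC.eval z‖ ≤ B ^ n.totient * (max 1 ‖z‖) ^ d := fun z =>
    (psi_eval_bound n hn f₂ g₂ D hD₃ hD₄ z).trans
      (mul_le_mul_of_nonneg_right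
        (pow_le_pow_left₀ (add_nonneg (len_nonneg _) (len_nonneg _)) hB₂ _) (by positivity))
  have hprod : ‖(FC.roots.map GC.eval).prod‖ ≤
      (B ^ n.totient) ^ (Multiset.card FC.roots) * ((FC.roots.map fun a => max 1 ‖a‖).prod) ^ d := by
    generalize FC.roots = S
    induction S using Multiset.induction_on with
    | empty => simp
    | cons a S ih =>
      simp only [Multiset.map_cons, Multiset.prod_cons, Multiset.card_cons, norm_mul]
      calc _ ≤ (B ^ n.totient * (max 1 ‖a‖) ^ d) * ((B ^ n.totient) ^ (Multiset.card S) *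
                ((S.map fun a => max 1 ‖a‖).prod) ^ d) := by
              apply mul_le_mul (hE a) ih (norm_nonneg _) (by positivity)
        _ = _ := by ring
  have hcard : Multiset.card FC.roots ≤ m.totient * D :=
    (card_roots' FC).trans (hFCd.le.trans hFd)
  rw [norm_mul, norm_pow]
  calc ‖FC.leadingCoeff‖ ^ d * ‖(FC.roots.map GC.eval).prod‖
      ≤ ‖FC.leadingCoeff‖ ^ d * ((B ^ n.totient) ^ (Multiset.card FC.roots) *
          ((FC.roots.map fun a => max 1 ‖a‖).prod) ^ d) := by gcongr
    _ = (B ^ n.totient) ^ (Multiset.card FC.roots) * FC.mahlerMeasure ^ d := by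
        rw [mahlerMeasure_eq_leadingCoeff_mul_prod_roots]; ring
    _ ≤ (B ^ n.totient) ^ (m.totient * D) * (B ^ m.totient) ^ d := by
        gcongr
        · exact pow_nonneg (mahlerMeasure_nonneg _) _
        · exact one_le_pow₀ hB
        · exact mahlerMeasure_nonneg _
    _ = B ^ (2 * D * (m.totient * n.totient)) := by
        rw [hd]; ring
    _ ≤ _ := by
        apply pow_le_pow_right₀ hB
        gcongr <;> exact Nat.totient_le _

lemma finord (p : ℕ) [Fact p.Prime] (x : AlgebraicClosure (ZMod p)) (hx : x ≠ 0) :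
    0 < orderOf x := by
  have hIntz : IsIntegral (ZMod p) x := (AlgebraicClosure.isAlgebraic (ZMod p)).isAlgebraic x |>.isIntegral
  have : FiniteDimensional (ZMod p) (IntermediateField.adjoin (ZMod p) {x}) :=
    IntermediateField.adjoin.finiteDimensional hIntz
  have : Finite (IntermediateField.adjoin (ZMod p) {x}) := Module.finite_of_finite (ZMod p)
  have := Fintype.ofFinite (IntermediateField.adjoin (ZMod p) {x})
  let y : IntermediateField.adjoin (ZMod p) {x} :=
    ⟨x, IntermediateField.mem_adjoin_simple_self (ZMod p) x⟩
  have hy : y ≠ 0 := by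
    intro h; apply hx; exact congrArg Subtype.val h
  have h := FiniteField.pow_card_sub_one_eq_one y hy
  have h2 : x ^ (Fintype.card (IntermediateField.adjoin (ZMod p) {x}) - 1) = 1 := congrArg Subtype.val h
  rw [orderOf_pos_iff, isOfFinOrder_iff_pow_eq_one]
  exact ⟨_, Nat.sub_pos_of_lt Fintype.one_lt_card, h2⟩

lemma indep_pow (f₁ g₁ f₂ g₂ : Polynomial ℤ)
    (hf₁ : f₁ ≠ 0) (hg₁ : g₁ ≠ 0) (hf₂ : f₂ ≠ 0) (hg₂ : g₂ ≠ 0)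
    (hindep : ∀ k l : ℤ,
      (algebraMap (Polynomial ℚ) (RatFunc ℚ) (f₁.map (Int.castRingHom ℚ)) /
        algebraMap (Polynomial ℚ) (RatFunc ℚ) (g₁.map (Int.castRingHom ℚ))) ^ k *
      (algebraMap (Polynomial ℚ) (RatFunc ℚ) (f₂.map (Int.castRingHom ℚ)) /
        algebraMap (Polynomial ℚ) (RatFunc ℚ) (g₂.map (Int.castRingHom ℚ))) ^ l = 1 →
      k = 0 ∧ l = 0) (i j i' j' : ℕ) (h : f₁ ^ i * f₂ ^ j * (g₁ ^ i' * g₂ ^ j') =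
      f₁ ^ i' * f₂ ^ j' * (g₁ ^ i * g₂ ^ j)) : i = i' ∧ j = j' := by
  let Φ : ℤ[X] →+* RatFunc ℚ :=
    (algebraMap (Polynomial ℚ) (RatFunc ℚ)).comp (mapRingHom (Int.castRingHom ℚ))
  have hΦ : ∀ f : ℤ[X], f ≠ 0 → Φ f ≠ 0 := by
    intro f hf
    simp only [Φ, RingHom.comp_apply, coe_mapRingHom]
    rw [Ne, FaithfulSMul.algebraMap_eq_zero_iff]
    exact (Polynomial.map_ne_zero_iff (RingHom.injective_int _)).mpr hf
  have hi : ∀ k l : ℤ, (Φ f₁ / Φ g₁) ^ k * (Φ f₂ / Φ g₂) ^ l = 1 → k = 0 ∧ l = 0 := hindep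
  have h1 := congrArg Φ h
  simp only [map_mul, map_pow] at h1
  have a1 := hΦ _ hf₁
  have a2 := hΦ _ hf₂
  have a3 := hΦ _ hg₁
  have a4 := hΦ _ hg₂
  have := hi ((i:ℤ) - i') ((j:ℤ) - j') (by
    rw [zpow_sub₀ (div_ne_zero a1 a3), zpow_sub₀ (div_ne_zero a2 a4)]
    simp only [zpow_natCast, div_pow]
    field_simp
    linear_combination h1)
  omega

lemma psi_ne_zero (m : ℕ) (hm : 0 < m) (f g : ℤ[X]) (h : f ^ m ≠ g ^ m) : psi m f g ≠ 0 := by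
  intro h0
  have h1 := psi_prod m hm f g
  rw [h0, Polynomial.map_zero] at h1
  obtain ⟨μ, hμ, h2⟩ := Finset.prod_eq_zero_iff.mp h1.symm
  apply h
  apply Polynomial.map_injective (Int.castRingHom ℂ) (RingHom.injective_int _)
  rw [Polynomial.map_pow, Polynomial.map_pow, sub_eq_zero.mp h2, mul_pow, ← C_pow,
    ((mem_primitiveRoots hm).mp hμ).pow_eq_one]
  simp

lemma psi_zero (m : ℕ) (hm : 0 < m) (f g : ℤ[X]) (hf : f ≠ 0) (hcop : IsRelPrime f g) (z : ℂ)
    (h : ((psi m f g).map (Int.castRingHom ℂ)).eval z = 0) :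
    aeval z g ≠ 0 ∧ IsPrimitiveRoot (aeval z f / aeval z g) m := by
  rw [psi_prod m hm, eval_prod] at h
  obtain ⟨μ, hμ, h2⟩ := Finset.prod_eq_zero_iff.mp h
  have h3 : aeval z f = μ * aeval z g := by
    have : eval z (f.map (Int.castRingHom ℂ)) - μ * eval z (g.map (Int.castRingHom ℂ)) = 0 := by
      simpa using h2
    rw [eval_map, eval_map] at this
    exact sub_eq_zero.mp this
  have h4 : aeval z g ≠ 0 := by
    intro h5
    rw [h5, mul_zero] at h3
    exact no_common_root f g hf hcop z h3 h5
  refine ⟨h4, ?_⟩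
  rw [h3, mul_div_cancel_right₀ _ h4]
  exact (mem_primitiveRoots hm).mp hμ




/-- Corollary: for multiplicatively independent non-zero `φ = f₁/g₁, ρ = f₂/g₂ ∈ ℚ(X)`,
there are effectively computable constants `c₁, c₂, c₃` such that for every prime `p > c₁`,
for all but at most `c₂` elements `α ∈ 𝔽̄_p` (excluding zeros and poles of the reductions),
`max(ord_p(φ(α)), ord_p(ρ(α))) ≥ c₃ (log p)^{1/2}`. -/
theorem stmt_13 (f₁ g₁ f₂ g₂ : Polynomial ℤ)
    (hf₁ : f₁ ≠ 0) (hg₁ : g₁ ≠ 0) (hf₂ : f₂ ≠ 0) (hg₂ : g₂ ≠ 0)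
    (hcop₁ : IsRelPrime f₁ g₁) (hcop₂ : IsRelPrime f₂ g₂)
    (hindep : ∀ k l : ℤ,
      (algebraMap (Polynomial ℚ) (RatFunc ℚ) (f₁.map (Int.castRingHom ℚ)) /
        algebraMap (Polynomial ℚ) (RatFunc ℚ) (g₁.map (Int.castRingHom ℚ))) ^ k *
      (algebraMap (Polynomial ℚ) (RatFunc ℚ) (f₂.map (Int.castRingHom ℚ)) /
        algebraMap (Polynomial ℚ) (RatFunc ℚ) (g₂.map (Int.castRingHom ℚ))) ^ l = 1 →
      k = 0 ∧ l = 0) :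
    ∃ c₁ c₂ c₃ : ℝ, 0 < c₃ ∧ ∀ (p : ℕ) (_ : Fact p.Prime), c₁ < (p : ℝ) →
      Set.Finite {α : AlgebraicClosure (ZMod p) |
        (Polynomial.eval₂ (Int.castRingHom (AlgebraicClosure (ZMod p))) α f₁ ≠ 0 ∧
          Polynomial.eval₂ (Int.castRingHom (AlgebraicClosure (ZMod p))) α g₁ ≠ 0 ∧
          Polynomial.eval₂ (Int.castRingHom (AlgebraicClosure (ZMod p))) α f₂ ≠ 0 ∧
          Polynomial.eval₂ (Int.castRingHom (AlgebraicClosure (ZMod p))) α g₂ ≠ 0) ∧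
        (max
          (orderOf (Polynomial.eval₂ (Int.castRingHom (AlgebraicClosure (ZMod p))) α f₁ /
            Polynomial.eval₂ (Int.castRingHom (AlgebraicClosure (ZMod p))) α g₁))
          (orderOf (Polynomial.eval₂ (Int.castRingHom (AlgebraicClosure (ZMod p))) α f₂ /
            Polynomial.eval₂ (Int.castRingHom (AlgebraicClosure (ZMod p))) α g₂)) : ℝ) <
          c₃ * Real.sqrt (Real.log (p : ℝ))} ∧
      ({α : AlgebraicClosure (ZMod p) |
        (Polynomial.eval₂ (Int.castRingHom (AlgebraicClosure (ZMod p))) α f₁ ≠ 0 ∧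
          Polynomial.eval₂ (Int.castRingHom (AlgebraicClosure (ZMod p))) α g₁ ≠ 0 ∧
          Polynomial.eval₂ (Int.castRingHom (AlgebraicClosure (ZMod p))) α f₂ ≠ 0 ∧
          Polynomial.eval₂ (Int.castRingHom (AlgebraicClosure (ZMod p))) α g₂ ≠ 0) ∧
        (max
          (orderOf (Polynomial.eval₂ (Int.castRingHom (AlgebraicClosure (ZMod p))) α f₁ /
            Polynomial.eval₂ (Int.castRingHom (AlgebraicClosure (ZMod p))) α g₁))
          (orderOf (Polynomial.eval₂ (Int.castRingHom (AlgebraicClosure (ZMod p))) α f₂ /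
            Polynomial.eval₂ (Int.castRingHom (AlgebraicClosure (ZMod p))) α g₂)) : ℝ) <
          c₃ * Real.sqrt (Real.log (p : ℝ))}.ncard : ℝ) ≤ c₂ := by
  have hind := indep_pow f₁ g₁ f₂ g₂ hf₁ hg₁ hf₂ hg₂ hindep
  obtain ⟨N₀, hN₀⟩ := torsion_bound f₁ g₁ f₂ g₂ hind
  have hpow : ∀ m : ℕ, 0 < m → f₁ ^ m ≠ g₁ ^ m := by
    intro m hm h
    have := (hind m 0 0 0 (by simpa using h)).1
    omega
  set PP : ℤ[X] := ∏ m ∈ Finset.Ico 1 N₀, (f₁ ^ m - g₁ ^ m) with hPP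
  have hPP0 : PP ≠ 0 := by
    rw [hPP, Finset.prod_ne_zero_iff]
    intro m hm
    exact sub_ne_zero.mpr (hpow m (by simp at hm; omega))
  set D : ℕ := f₁.natDegree + g₁.natDegree + f₂.natDegree + g₂.natDegree + 1 with hD
  set B : ℝ := len f₁ + len g₁ + len f₂ + len g₂ with hB
  have l1 := one_le_len f₁ hf₁
  have l2 := len_nonneg g₁
  have l3 := len_nonneg f₂
  have l4 := len_nonneg g₂
  have hB1 : 1 ≤ B := by linarith
  have hlogB : 0 ≤ Real.log B := Real.log_nonneg hB1
  set E : ℝ := 2 * D * Real.log B + 1 with hE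
  have hEpos : 0 < E := by positivity
  refine ⟨max 1 |(PP.leadingCoeff : ℝ)|, PP.natDegree, 1 / Real.sqrt E, by positivity, ?_⟩
  intro p hp hpc
  have hp1 : (1:ℝ) < p := lt_of_le_of_lt (le_max_left _ _) hpc
  have hp_PP : |(PP.leadingCoeff : ℝ)| < p := lt_of_le_of_lt (le_max_right _ _) hpc
  have hdvd : ∀ R : ℤ, ((R : ℤ) : AlgebraicClosure (ZMod p)) = 0 → |(R : ℝ)| < p → R = 0 := by
    intro R hR hlt
    rw [CharP.intCast_eq_zero_iff (AlgebraicClosure (ZMod p)) p] at hR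
    apply Int.eq_zero_of_abs_lt_dvd hR
    exact_mod_cast hlt
  classical
  set ι := Int.castRingHom (AlgebraicClosure (ZMod p)) with hι
  have hPP_p : PP.map ι ≠ 0 := by
    intro h
    have h1 : (PP.map ι).coeff PP.natDegree = 0 := by rw [h]; simp
    rw [coeff_map] at h1
    have := hdvd _ h1 hp_PP
    exact hPP0 (leadingCoeff_eq_zero.mp this)
  have hsub : {α : AlgebraicClosure (ZMod p) |
        (Polynomial.eval₂ ι α f₁ ≠ 0 ∧ Polynomial.eval₂ ι α g₁ ≠ 0 ∧
          Polynomial.eval₂ ι α f₂ ≠ 0 ∧ Polynomial.eval₂ ι α g₂ ≠ 0) ∧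
        (max (orderOf (Polynomial.eval₂ ι α f₁ / Polynomial.eval₂ ι α g₁))
          (orderOf (Polynomial.eval₂ ι α f₂ / Polynomial.eval₂ ι α g₂)) : ℝ) <
          1 / Real.sqrt E * Real.sqrt (Real.log (p : ℝ))} ⊆
      ((PP.map ι).roots.toFinset : Set (AlgebraicClosure (ZMod p))) := by
    rintro α ⟨⟨ha, hb, hc, hd⟩, hmax⟩
    set a := Polynomial.eval₂ ι α f₁ / Polynomial.eval₂ ι α g₁ with haa
    set b := Polynomial.eval₂ ι α f₂ / Polynomial.eval₂ ι α g₂ with hbb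
    have hm : 0 < orderOf a := finord p a (div_ne_zero ha hb)
    have hn : 0 < orderOf b := finord p b (div_ne_zero hc hd)
    have hap := IsPrimitiveRoot.orderOf a
    have hbp := IsPrimitiveRoot.orderOf b
    set m := orderOf a
    set n := orderOf b
    by_cases hlt : Nat.lcm m n < N₀
    · simp only [Finset.mem_coe, Multiset.mem_toFinset]
      rw [mem_roots hPP_p, IsRoot.def, eval_map, hPP, eval₂_finsetProd]
      apply Finset.prod_eq_zero (i := m)
      · rw [Finset.mem_Ico]
        exact ⟨hm, lt_of_le_of_lt (Nat.le_of_dvd (Nat.lcm_pos hm hn) (Nat.dvd_lcm_left m n)) hlt⟩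
      · have := hap.pow_eq_one
        rw [haa, div_pow, div_eq_one_iff_eq (pow_ne_zero _ hb)] at this
        rw [eval₂_sub, eval₂_pow, eval₂_pow, this, sub_self]
    · exfalso
      set F := psi m f₁ g₁ with hF
      set G := psi n f₂ g₂ with hG
      have hF0 : F ≠ 0 := psi_ne_zero m hm f₁ g₁ (hpow m hm)
      have hGd : G.natDegree ≤ n.totient * D :=
        psi_natDegree n hn f₂ g₂ D (by omega) (by omega)
      set R : ℤ := resultant F G F.natDegree (n.totient * D) with hR
      have hcop : IsCoprime (F.map (Int.castRingHom ℂ)) (G.map (Int.castRingHom ℂ)) := by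
        rw [isCoprime_iff_aeval_ne_zero_of_isAlgClosed (k := ℂ) (K := ℂ)]
        intro z
        by_contra hcon
        push Not at hcon
        obtain ⟨z1, z2⟩ := hcon
        obtain ⟨u1, u2⟩ := psi_zero m hm f₁ g₁ hf₁ hcop₁ z (by simpa using z1)
        obtain ⟨u3, u4⟩ := psi_zero n hn f₂ g₂ hf₂ hcop₂ z (by simpa using z2)
        exact hlt (hN₀ z m n hm hn u1 u3 u2 u4)
      have hinj : Function.Injective (Int.castRingHom ℂ) := RingHom.injective_int _
      have hR0 : R ≠ 0 := by
        have r1 := resultant_ne_zero _ _ hcop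
        rw [natDegree_map_eq_of_injective hinj, natDegree_map_eq_of_injective hinj,
          resultant_map_map] at r1
        have r2 : resultant F G ≠ 0 := by
          intro h; apply r1; rw [h]; simp
        obtain ⟨k, hk⟩ := Nat.exists_eq_add_of_le hGd
        rw [hR, hk, resultant_add_right_deg _ _ _ _ _ le_rfl]
        exact mul_ne_zero (pow_ne_zero _ (leadingCoeff_ne_zero.mpr hF0)) r2
      have hRb : |(R : ℝ)| ≤ B ^ (2 * D * (m * n)) :=
        res_bound m n hm hn f₁ g₁ f₂ g₂ D (by omega) (by omega) (by omega) (by omega) B hB1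
          (by linarith) (by linarith)
      have htn : 0 < n.totient := Nat.totient_pos.mpr hn
      obtain ⟨u, v, -, -, huv⟩ := exists_mul_add_mul_eq_C_resultant F G le_rfl hGd
        (Or.inr (Nat.mul_ne_zero htn.ne' (by omega)))
      have hRp : ((R : ℤ) : AlgebraicClosure (ZMod p)) = 0 := by
        have e := congrArg (eval₂ ι α) huv
        rw [eval₂_add, eval₂_mul, eval₂_mul, psi_root m hm f₁ g₁ α hb hap,
          psi_root n hn f₂ g₂ α hd hbp, eval₂_C] at e
        simpa using e.symm
      apply hR0
      apply hdvd R hRp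
      refine lt_of_le_of_lt hRb ?_
      have hlogp : 0 < Real.log p := Real.log_pos hp1
      have hm' : (m : ℝ) < 1 / Real.sqrt E * Real.sqrt (Real.log p) :=
        lt_of_le_of_lt (le_max_left _ _) hmax
      have hn' : (n : ℝ) < 1 / Real.sqrt E * Real.sqrt (Real.log p) :=
        lt_of_le_of_lt (le_max_right _ _) hmax
      have hmn : (m : ℝ) * n < Real.log p / E := by
        calc (m : ℝ) * n < (1 / Real.sqrt E * Real.sqrt (Real.log p)) *
              (1 / Real.sqrt E * Real.sqrt (Real.log p)) :=
              mul_lt_mul'' hm' hn' (by positivity) (by positivity)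
          _ = (Real.sqrt (Real.log p) * Real.sqrt (Real.log p)) / (Real.sqrt E * Real.sqrt E) := by
              field_simp
          _ = _ := by rw [Real.mul_self_sqrt hlogp.le, Real.mul_self_sqrt hEpos.le]
      rw [lt_div_iff₀ hEpos] at hmn
      rw [← Real.log_lt_log_iff (by positivity) (by linarith), Real.log_pow]
      push_cast
      have : (0:ℝ) < m * n := by positivity
      nlinarith
  have hfin := (PP.map ι).roots.toFinset.finite_toSet
  refine ⟨hfin.subset hsub, ?_⟩
  have h1 := Set.ncard_le_ncard hsub hfin
  rw [Set.ncard_coe_finset] at h1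
  have h2 : (PP.map ι).roots.toFinset.card ≤ PP.natDegree :=
    (Multiset.toFinset_card_le _).trans ((card_roots' _).trans natDegree_map_le)
  exact_mod_cast h1.trans h2
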